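/- (Lemma 4) Let Ω_app be a state space and ξ_1, …, ξ_N ∈ Ω_app a perfectly distinguishable family of states, i.e., there is an observable {A_n}_{n=1}^N with A_n(ξ_m) = δ_{nm}. Then for every state space Ω_sys and every family τ_1, …, τ_N of channels on Ω_sys, there exists a channel Θ on the minimal tensor product Ω_sys ⊗_min Ω_app such that each ξ_n implements τ_n through Θ, i.e., (e ⊗ u_app)(Θ(ω ⊗ ξ_n)) = e(τ_n(ω)) for all ω ∈ Ω_sys, all effects e on Ω_sys, and all n. -/

import Mathlib

open scoped BigOperators

/-- A state space: a compact convex subset `Ω` of a finite-dimensional real vector space `V`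
which spans `V` and whose affine hull does not contain the origin. -/
def IsStateSpace {V : Type*} [NormedAddCommGroup V] [NormedSpace ℝ V] (Ω : Set V) : Prop :=
  IsCompact Ω ∧ Convex ℝ Ω ∧ Submodule.span ℝ Ω = ⊤ ∧ (0 : V) ∉ (affineSpan ℝ Ω : Set V)

/-- An effect on `Ω`: a linear functional taking values in `[0,1]` on `Ω`. -/
def IsEffect {V : Type*} [AddCommGroup V] [Module ℝ V] (Ω : Set V) (e : V →ₗ[ℝ] ℝ) : Prop :=
  ∀ ω ∈ Ω, e ω ∈ Set.Icc (0 : ℝ) 1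

/-- The unit effect on `Ω`: the linear functional equal to `1` on `Ω`. -/
def IsUnitEffect {V : Type*} [AddCommGroup V] [Module ℝ V] (Ω : Set V)
    (u : V →ₗ[ℝ] ℝ) : Prop :=
  ∀ ω ∈ Ω, u ω = 1

/-- An observable on `Ω`: a finite family of effects summing to the unit effect. -/
def IsObservable {V : Type*} [AddCommGroup V] [Module ℝ V] (Ω : Set V) {X : Type*} [Fintype X]
    (e : X → (V →ₗ[ℝ] ℝ)) : Prop :=
  (∀ x, IsEffect Ω (e x)) ∧ ∀ ω ∈ Ω, ∑ x, e x ω = 1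

/-- The fidelity of two states `ω, σ ∈ Ω`: the infimum over all observables `{e_x}` on `Ω`
of `∑ x, √(e_x ω) · √(e_x σ)`. -/
noncomputable def fidelity {V : Type*} [AddCommGroup V] [Module ℝ V] (Ω : Set V)
    (ω σ : V) : ℝ :=
  sInf { r | ∃ (nn : ℕ) (e : Fin nn → (V →ₗ[ℝ] ℝ)), IsObservable Ω e ∧
    r = ∑ x, Real.sqrt (e x ω) * Real.sqrt (e x σ) }

/-- The tensor product of two states, realized in the function space indexed by the
product of the index sets. -/
def tmul {ι₁ ι₂ : Type} (ω : ι₁ → ℝ) (σ : ι₂ → ℝ) : ι₁ × ι₂ → ℝ :=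
  fun p => ω p.1 * σ p.2

/-- Auxiliary: partial application of a functional on the second factor. -/
def curryMap {ι₁ ι₂ : Type} (f : (ι₂ → ℝ) →ₗ[ℝ] ℝ) : (ι₁ × ι₂ → ℝ) →ₗ[ℝ] (ι₁ → ℝ) where
  toFun μ := fun i => f (fun j => μ (i, j))
  map_add' μ ν := by funext i; exact f.map_add _ _
  map_smul' c μ := by funext i; exact f.map_smul c _

/-- The tensor product `e ⊗ f` of two effects, as a linear functional on the
composite space; it satisfies `(e ⊗ f)(ω ⊗ σ) = e ω · f σ`. -/
def etmul {ι₁ ι₂ : Type} (e : (ι₁ → ℝ) →ₗ[ℝ] ℝ) (f : (ι₂ → ℝ) →ₗ[ℝ] ℝ) :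
    (ι₁ × ι₂ → ℝ) →ₗ[ℝ] ℝ :=
  e.comp (curryMap f)

/-- The linear map `β ⊗ id` on the composite space. -/
def lTensorId {ι₁ ι₂ : Type} (β : (ι₁ → ℝ) →ₗ[ℝ] (ι₁ → ℝ)) :
    (ι₁ × ι₂ → ℝ) →ₗ[ℝ] (ι₁ × ι₂ → ℝ) where
  toFun μ := fun p => β (fun i => μ (i, p.2)) p.1
  map_add' μ ν := by funext p; exact congrFun (β.map_add _ _) p.1
  map_smul' c μ := by funext p; exact congrFun (β.map_smul c _) p.1

/-- The minimal tensor product of two state spaces: the convex hull of product states. -/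
def minTensor {ι₁ ι₂ : Type} (Ω₁ : Set (ι₁ → ℝ)) (Ω₂ : Set (ι₂ → ℝ)) :
    Set (ι₁ × ι₂ → ℝ) :=
  convexHull ℝ {μ | ∃ ω ∈ Ω₁, ∃ σ ∈ Ω₂, μ = tmul ω σ}

/-- The maximal tensor product of two state spaces: all `μ` normalized by the unit effects
and giving nonnegative probabilities on all product effects. -/
def maxTensor {ι₁ ι₂ : Type} (Ω₁ : Set (ι₁ → ℝ)) (Ω₂ : Set (ι₂ → ℝ)) :
    Set (ι₁ × ι₂ → ℝ) :=
  {μ | (∀ u₁ u₂, IsUnitEffect Ω₁ u₁ → IsUnitEffect Ω₂ u₂ → etmul u₁ u₂ μ = 1) ∧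
    ∀ e f, IsEffect Ω₁ e → IsEffect Ω₂ f → 0 ≤ etmul e f μ}

/-- A composite state space of `Ω₁` and `Ω₂`: a compact convex set between the minimal
and the maximal tensor products. -/
def IsComposite {ι₁ ι₂ : Type} [Fintype ι₁] [Fintype ι₂] (Ω₁ : Set (ι₁ → ℝ))
    (Ω₂ : Set (ι₂ → ℝ)) (Ωtot : Set (ι₁ × ι₂ → ℝ)) : Prop :=
  IsCompact Ωtot ∧ Convex ℝ Ωtot ∧ minTensor Ω₁ Ω₂ ⊆ Ωtot ∧ Ωtot ⊆ maxTensor Ω₁ Ω₂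

/-- A program `ξ ∈ Ω_app` implements the dynamics `α` on `Ω_sys` through the dynamics `Λ`
on the composite: `(e ⊗ u_app)(Λ(ω ⊗ ξ)) = e(α ω)` for all states `ω` and effects `e`. -/
def Implements {ι₁ ι₂ : Type} (Ωsys : Set (ι₁ → ℝ)) (Ωapp : Set (ι₂ → ℝ))
    (Λ : (ι₁ × ι₂ → ℝ) →ₗ[ℝ] (ι₁ × ι₂ → ℝ)) (ξ : ι₂ → ℝ)
    (α : (ι₁ → ℝ) →ₗ[ℝ] (ι₁ → ℝ)) : Prop :=
  ∀ ω ∈ Ωsys, ∀ e : (ι₁ → ℝ) →ₗ[ℝ] ℝ, IsEffect Ωsys e →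
    ∀ u₂ : (ι₂ → ℝ) →ₗ[ℝ] ℝ, IsUnitEffect Ωapp u₂ →
      etmul e u₂ (Λ (tmul ω ξ)) = e (α ω)

/-- The product state `ω ⊗ σ`, as a linear map in `ω`. -/
def tmulRight {ι₁ ι₂ : Type} (σ : ι₂ → ℝ) : (ι₁ → ℝ) →ₗ[ℝ] (ι₁ × ι₂ → ℝ) where
  toFun ω := tmul ω σ
  map_add' ω ω' := by funext p; exact add_mul _ _ _
  map_smul' c ω := by funext p; exact mul_assoc _ _ _

theorem tmulRight_apply {ι₁ ι₂ : Type} (σ : ι₂ → ℝ) (ω : ι₁ → ℝ) :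
    tmulRight σ ω = tmul ω σ := rfl

theorem curryMap_tmul {ι₁ ι₂ : Type} (f : (ι₂ → ℝ) →ₗ[ℝ] ℝ) (ω : ι₁ → ℝ) (σ : ι₂ → ℝ) :
    curryMap f (tmul ω σ) = f σ • ω := by
  funext i
  exact (f.map_smul (ω i) σ).trans (mul_comm _ _)

theorem etmul_tmul {ι₁ ι₂ : Type} (e : (ι₁ → ℝ) →ₗ[ℝ] ℝ) (f : (ι₂ → ℝ) →ₗ[ℝ] ℝ)
    (ω : ι₁ → ℝ) (σ : ι₂ → ℝ) : etmul e f (tmul ω σ) = f σ * e ω := by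
  rw [etmul, LinearMap.comp_apply, curryMap_tmul, map_smul, smul_eq_mul]

/-- Measure the family `A` on the second factor and, on outcome `n`, apply `τ n` to the first
factor and prepare `ξ n` on the second. -/
def measurePrepare {ι₁ ι₂ : Type} {X : Type*} [Fintype X] (A : X → ((ι₂ → ℝ) →ₗ[ℝ] ℝ))
    (τ : X → ((ι₁ → ℝ) →ₗ[ℝ] (ι₁ → ℝ))) (ξ : X → (ι₂ → ℝ)) :
    (ι₁ × ι₂ → ℝ) →ₗ[ℝ] (ι₁ × ι₂ → ℝ) :=
  ∑ n, tmulRight (ξ n) ∘ₗ τ n ∘ₗ curryMap (A n)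

theorem measurePrepare_tmul {ι₁ ι₂ : Type} {X : Type*} [Fintype X]
    (A : X → ((ι₂ → ℝ) →ₗ[ℝ] ℝ)) (τ : X → ((ι₁ → ℝ) →ₗ[ℝ] (ι₁ → ℝ)))
    (ξ : X → (ι₂ → ℝ)) (ω : ι₁ → ℝ) (σ : ι₂ → ℝ) :
    measurePrepare A τ ξ (tmul ω σ) = ∑ n, A n σ • tmul (τ n ω) (ξ n) := by
  simp only [measurePrepare, LinearMap.sum_apply, LinearMap.comp_apply, curryMap_tmul, map_smul,
    tmulRight_apply]

theorem mapsTo_measurePrepare_minTensor {ι₁ ι₂ : Type} {X : Type*} [Fintype X]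
    {Ω₁ : Set (ι₁ → ℝ)} {Ω₂ : Set (ι₂ → ℝ)} {A : X → ((ι₂ → ℝ) →ₗ[ℝ] ℝ)}
    {τ : X → ((ι₁ → ℝ) →ₗ[ℝ] (ι₁ → ℝ))} {ξ : X → (ι₂ → ℝ)} (hA : IsObservable Ω₂ A)
    (hτ : ∀ n, Set.MapsTo (τ n) Ω₁ Ω₁) (hξ : ∀ n, ξ n ∈ Ω₂) :
    Set.MapsTo (measurePrepare A τ ξ) (minTensor Ω₁ Ω₂) (minTensor Ω₁ Ω₂) := by
  refine convexHull_min ?_ ((convex_convexHull ℝ _).linear_preimage _)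
  rintro _ ⟨ω, hω, σ, hσ, rfl⟩
  change measurePrepare A τ ξ (tmul ω σ) ∈ minTensor Ω₁ Ω₂
  rw [measurePrepare_tmul]
  exact (convex_convexHull ℝ _).sum_mem (fun n _ => (hA.1 n σ hσ).1) (hA.2 σ hσ)
    fun n _ => subset_convexHull ℝ _ ⟨τ n ω, hτ n hω, ξ n, hξ n, rfl⟩

/-- Lemma 4: a perfectly distinguishable family of apparatus states can program any `N`
channels on any system through a channel on the minimal tensor product. -/
theorem distinguishable_programs_channels {ι₂ : Type} [Fintype ι₂]
    (Ωapp : Set (ι₂ → ℝ)) (happ : IsStateSpace Ωapp)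
    (N : ℕ) (ξ : Fin N → (ι₂ → ℝ)) (hξ : ∀ n, ξ n ∈ Ωapp)
    (A : Fin N → ((ι₂ → ℝ) →ₗ[ℝ] ℝ)) (hA : IsObservable Ωapp A)
    (hAδ : ∀ n m : Fin N, A n (ξ m) = if n = m then 1 else 0) :
    ∀ (ι₁ : Type) [Fintype ι₁], ∀ Ωsys : Set (ι₁ → ℝ), IsStateSpace Ωsys →
      ∀ τ : Fin N → ((ι₁ → ℝ) →ₗ[ℝ] (ι₁ → ℝ)), (∀ n, Set.MapsTo (τ n) Ωsys Ωsys) →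
        ∃ Θ : (ι₁ × ι₂ → ℝ) →ₗ[ℝ] (ι₁ × ι₂ → ℝ),
          Set.MapsTo Θ (minTensor Ωsys Ωapp) (minTensor Ωsys Ωapp) ∧
          ∀ n, Implements Ωsys Ωapp Θ (ξ n) (τ n) := by
  intro ι₁ _ Ωsys _ τ hτ
  refine ⟨measurePrepare A τ ξ, mapsTo_measurePrepare_minTensor hA hτ hξ, ?_⟩
  intro n ω _ e _ u hu
  simp [measurePrepare_tmul, etmul_tmul, hAδ, hu _ (hξ n)]
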